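/- arXiv:1004.5589 — 7 statements merged into one kernel-verified Lean document; each statement's English description precedes it below -/
import Mathlib

section
/- Define a replacement step on finite prefix codes over A: step (r1) transforms a finite prefix code C into (C \ {c}) ∪ c·A for some chosen c ∈ C, where c·A = {c·a : a ∈ A}; step (r2) is the inverse operation (if c·A ⊆ C′ for some word c, replace C′ by (C′ \ c·A) ∪ {c}). Then for all finite prefix codes P₁, P₂ ⊆ A*: ends(P₁·A*) = ends(P₂·A*) if and only if P₂ can be transformed into P₁ by a finite sequence of replacement steps of types (r1) and (r2), i.e., P₁ and P₂ are related by the reflexive–transitive closure of the symmetric relation generated by (r1). -/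
/-- A finite set of words is a prefix code iff no two distinct elements are
prefix-comparable. -/
def IsPrefixCode {k : ℕ} (P : Finset (List (Fin k))) : Prop :=
  ∀ u ∈ P, ∀ v ∈ P, u <+: v → u = v

/-- The set of ends of the right ideal `P·A*`: all infinite sequences having some
finite initial segment in `P`. -/
def ends {k : ℕ} (P : Finset (List (Fin k))) : Set (ℕ → Fin k) :=
  {s | ∃ n : ℕ, (List.ofFn fun i : Fin n => s (i : ℕ)) ∈ P}

/-- Replacement step (r1): for a finite prefix code `C` and `c ∈ C`, replace `C` by
`(C \ {c}) ∪ c·A`.  Step (r2) is the inverse of this relation. -/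
def StepR1 {k : ℕ} (C C' : Finset (List (Fin k))) : Prop :=
  IsPrefixCode C ∧
    ∃ c ∈ C, C' = C.erase c ∪ (Finset.univ : Finset (Fin k)).image (fun a => c ++ [a])

theorem my_ofFn {k : ℕ} (s : ℕ → Fin k) (n : ℕ) :
    (List.ofFn fun i : Fin (n+1) => s (i : ℕ)) = (List.ofFn fun i : Fin n => s (i : ℕ)) ++ [s n] := by
  rw [List.ofFn_succ_last]
  simp

theorem my_ends {k : ℕ} {C C' : Finset (List (Fin k))} (h : StepR1 C C') : ends C = ends C' := by
  obtain ⟨-, c, hc, rfl⟩ := h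
  ext s
  constructor
  · rintro ⟨n, hn⟩
    by_cases h : (List.ofFn fun i : Fin n => s (i : ℕ)) = c
    · refine ⟨n+1, ?_⟩
      rw [my_ofFn, h]
      simp
    · exact ⟨n, Finset.mem_union_left _ (Finset.mem_erase.2 ⟨h, hn⟩)⟩
  · rintro ⟨n, hn⟩
    rcases Finset.mem_union.1 hn with h | h
    · exact ⟨n, Finset.mem_of_mem_erase h⟩
    · obtain ⟨a, -, ha⟩ := Finset.mem_image.1 h
      cases n with
      | zero => simp at ha
      | succ m =>
        rw [my_ofFn] at ha
        have := (List.append_inj' ha rfl).1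
        exact ⟨m, this ▸ hc⟩

theorem my_code {k : ℕ} {C C' : Finset (List (Fin k))} (h : StepR1 C C') : IsPrefixCode C' := by
  obtain ⟨hC, c, hc, rfl⟩ := h
  intro u hu v hv huv
  rcases Finset.mem_union.1 hu with hu | hu <;> rcases Finset.mem_union.1 hv with hv | hv
  · exact hC u (Finset.mem_of_mem_erase hu) v (Finset.mem_of_mem_erase hv) huv
  · obtain ⟨a, -, rfl⟩ := Finset.mem_image.1 hv
    rcases List.prefix_concat_iff.1 huv with h | h
    · simpa using h
    · exact absurd (hC u (Finset.mem_of_mem_erase hu) c hc h) (Finset.ne_of_mem_erase hu)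
  · obtain ⟨a, -, rfl⟩ := Finset.mem_image.1 hu
    exact absurd (hC c hc v (Finset.mem_of_mem_erase hv) ((List.prefix_append _ _).trans huv)).symm
      (Finset.ne_of_mem_erase hv)
  · obtain ⟨a, -, rfl⟩ := Finset.mem_image.1 hu
    obtain ⟨b, -, rfl⟩ := Finset.mem_image.1 hv
    exact huv.eq_of_length (by simp)

theorem my_trans_ends {k : ℕ} {P Q : Finset (List (Fin k))}
    (h : Relation.ReflTransGen (fun X Y => StepR1 X Y ∨ StepR1 Y X) P Q) : ends P = ends Q := by
  induction h with
  | refl => rfl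
  | tail _ h ih => 
    rcases h with h | h
    · exact ih.trans (my_ends h)
    · exact ih.trans (my_ends h).symm

theorem my_uniform {k : ℕ} (N : ℕ) (M : ℕ) : ∀ (P : Finset (List (Fin k))),
    ∑ c ∈ P, (k+1)^(N - c.length) ≤ M → IsPrefixCode P → (∀ c ∈ P, c.length ≤ N) →
    ∃ Q : Finset (List (Fin k)), (∀ c ∈ Q, c.length = N) ∧
      Relation.ReflTransGen (fun X Y => StepR1 X Y ∨ StepR1 Y X) P Q := by
  induction M with
  | zero =>
    intro P hM _ _
    refine ⟨P, fun c hc => ?_, .refl⟩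
    have := Finset.sum_eq_zero_iff.1 (Nat.le_zero.1 hM) c hc
    simp at this
  | succ M ih =>
    intro P hM hP hN
    by_cases hall : ∀ c ∈ P, c.length = N
    · exact ⟨P, hall, .refl⟩
    push Not at hall
    obtain ⟨c, hc, hcN⟩ := hall
    have hlt : c.length < N := lt_of_le_of_ne (hN c hc) hcN
    have hs : StepR1 P (P.erase c ∪ (Finset.univ : Finset (Fin k)).image (fun a => c ++ [a])) :=
      ⟨hP, c, hc, rfl⟩
    suffices hh : _ ∧ _ by
      obtain ⟨Q, hQ, hPQ⟩ := ih _ hh.1 (my_code hs) hh.2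
      exact ⟨Q, hQ, .head (.inl hs) hPQ⟩
    constructor
    · have h1 := Finset.sum_erase_add P (fun c => (k+1)^(N - c.length)) hc
      have h2 := Finset.sum_union_inter (s₁ := P.erase c)
        (s₂ := (Finset.univ : Finset (Fin k)).image (fun a => c ++ [a]))
        (f := fun c => (k+1)^(N - c.length))
      have h3 : ∑ x ∈ (Finset.univ : Finset (Fin k)).image (fun a => c ++ [a]), (k+1)^(N - x.length)
          = k * (k+1)^(N - (c.length + 1)) := by
        rw [Finset.sum_image (by intro a _ b _ h; simpa using h)]
        simp
      have h4 : (k+1)^(N - c.length) = (k+1) * (k+1)^(N - (c.length + 1)) := by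
        rw [← pow_succ']; congr 1; omega
      have h5 : 0 < (k+1)^(N - (c.length + 1)) := by positivity
      rw [h4, add_mul] at h1
      omega
    · intro w hw
      rcases Finset.mem_union.1 hw with h | h
      · exact hN w (Finset.mem_of_mem_erase h)
      · obtain ⟨a, -, rfl⟩ := Finset.mem_image.1 h
        simp; omega

theorem my_sub {k : ℕ} (hk : 2 ≤ k) (N : ℕ) {P Q : Finset (List (Fin k))}
    (hP : ∀ c ∈ P, c.length = N) (hQ : ∀ c ∈ Q, c.length = N) (h : ends P = ends Q) : P ⊆ Q := by
  intro c hc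
  have hcN := hP c hc
  let s : ℕ → Fin k := fun i => c.getD i ⟨0, by omega⟩
  have hs : (List.ofFn fun i : Fin N => s (i : ℕ)) = c := by
    subst hcN
    apply List.ext_getElem
    · simp
    · intro i h1 h2
      simp [s]
  have hm : s ∈ ends P := ⟨N, by rw [hs]; exact hc⟩
  rw [h] at hm
  obtain ⟨n, hn⟩ := hm
  have : n = N := by simpa using hQ _ hn
  subst this
  rwa [hs] at hn

theorem stmt1 (k : ℕ) (hk : 2 ≤ k) (P₁ P₂ : Finset (List (Fin k)))
    (hP₁ : IsPrefixCode P₁) (hP₂ : IsPrefixCode P₂) :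
    ends P₁ = ends P₂ ↔
      Relation.ReflTransGen (fun X Y => StepR1 X Y ∨ StepR1 Y X) P₂ P₁ := by
  constructor
  · intro h
    obtain ⟨Q₁, hQ₁, h₁⟩ := my_uniform ((P₁ ∪ P₂).sup List.length) _ P₁ le_rfl hP₁
      (fun c hc => Finset.le_sup (f := List.length) (Finset.mem_union_left _ hc))
    obtain ⟨Q₂, hQ₂, h₂⟩ := my_uniform ((P₁ ∪ P₂).sup List.length) _ P₂ le_rfl hP₂
      (fun c hc => Finset.le_sup (f := List.length) (Finset.mem_union_right _ hc))
    have he : ends Q₁ = ends Q₂ := by rw [← my_trans_ends h₁, h, my_trans_ends h₂]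
    have : Q₁ = Q₂ := (my_sub hk _ hQ₁ hQ₂ he).antisymm (my_sub hk _ hQ₂ hQ₁ he.symm)
    subst this
    refine h₂.trans ?_
    apply Relation.reflTransGen_swap.1
    exact Relation.ReflTransGen.mono (fun _ _ h => Or.symm h) _ _ h₁
  · intro h
    exact (my_trans_ends h).symm
end

section
/- If P₁, P₂ ⊆ A* are finite prefix codes such that ends(P₁·A*) = ends(P₂·A*), then μ(P₁) = μ(P₂). -/
/-- The Bernoulli measure of a finite set of words over an alphabet with `k` letters. -/
def mu (k : ℕ) (P : Finset (List (Fin k))) : ℚ :=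
  ∑ x ∈ P, (k : ℚ) ^ (-(x.length : ℤ))

/-- words of length m -/
def wordsOf (k m : ℕ) : Finset (List (Fin k)) :=
  (Finset.univ : Finset (Fin m → Fin k)).image List.ofFn

theorem mem_wordsOf {k m : ℕ} (w : List (Fin k)) : w ∈ wordsOf k m ↔ w.length = m := by
  unfold wordsOf
  simp only [Finset.mem_image, Finset.mem_univ, true_and]
  constructor
  · rintro ⟨f, rfl⟩; simp
  · rintro rfl; exact ⟨w.get, by simp⟩

theorem card_wordsOf (k m : ℕ) : (wordsOf k m).card = k ^ m := by
  unfold wordsOf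
  rw [Finset.card_image_of_injective _ List.ofFn_injective]
  simp

/-- extensions of P to length N -/
def extTo {k : ℕ} (N : ℕ) (P : Finset (List (Fin k))) : Finset (List (Fin k)) :=
  P.biUnion fun p => (wordsOf k (N - p.length)).image (fun w => p ++ w)

theorem card_extTo {k : ℕ} (N : ℕ) (P : Finset (List (Fin k))) (hP : IsPrefixCode P) :
    (extTo N P).card = ∑ p ∈ P, k ^ (N - p.length) := by
  unfold extTo
  rw [Finset.card_biUnion]
  · refine Finset.sum_congr rfl fun p _ => ?_
    rw [Finset.card_image_of_injective _ (List.append_right_injective p), card_wordsOf]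
  · intro u hu v hv huv
    rw [Function.onFun, Finset.disjoint_left]
    intro x hx hx'
    simp only [Finset.mem_image] at hx hx'
    obtain ⟨a, -, rfl⟩ := hx
    obtain ⟨b, -, hb⟩ := hx'
    have h1 : u <+: u ++ a := List.prefix_append _ _
    have h2 : v <+: u ++ a := hb ▸ List.prefix_append _ _
    rcases List.prefix_or_prefix_of_prefix h1 h2 with h | h
    · exact huv (hP u hu v hv h)
    · exact huv (hP v hv u hu h).symm

theorem mem_extTo {k : ℕ} (N : ℕ) (P : Finset (List (Fin k)))
    (hN : ∀ p ∈ P, p.length ≤ N) (s : ℕ → Fin k) :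
    (List.ofFn fun i : Fin N => s i) ∈ extTo N P ↔ s ∈ ends P := by
  unfold extTo ends
  simp only [Finset.mem_biUnion, Finset.mem_image, mem_wordsOf, Set.mem_setOf_eq]
  constructor
  · rintro ⟨p, hp, w, hw, h⟩
    refine ⟨p.length, ?_⟩
    convert hp
    apply List.ext_getElem (by simp)
    intro i h1 h2
    have h3 : i < (p ++ w).length := by simp; omega
    have : (p ++ w)[i] = s i := by simp [h]
    rw [List.getElem_append_left h2] at this
    simp [this]
  · rintro ⟨n, hn⟩
    have := hN _ hn
    simp only [List.length_ofFn] at this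
    obtain ⟨m, rfl⟩ := Nat.exists_eq_add_of_le this
    refine ⟨_, hn, List.ofFn fun i : Fin m => s (n + i), by simp, ?_⟩
    rw [List.ofFn_add]
    rfl

theorem length_extTo {k : ℕ} (N : ℕ) (P : Finset (List (Fin k)))
    (hN : ∀ p ∈ P, p.length ≤ N) (w : List (Fin k)) (hw : w ∈ extTo N P) : w.length = N := by
  unfold extTo at hw
  simp only [Finset.mem_biUnion, Finset.mem_image, mem_wordsOf] at hw
  obtain ⟨p, hp, w, hw, rfl⟩ := hw
  have := hN p hp
  simp; omega

theorem extTo_sub {k : ℕ} (hk : 2 ≤ k) (N : ℕ) (P Q : Finset (List (Fin k)))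
    (hN : ∀ p ∈ P, p.length ≤ N) (hQ : ∀ p ∈ Q, p.length ≤ N) (h : ends P = ends Q) :
    extTo N P ⊆ extTo N Q := by
  intro w hw
  have hl := length_extTo N P hN w hw
  obtain ⟨s, key⟩ : ∃ s : ℕ → Fin k, w = List.ofFn fun i : Fin N => s i := by
    refine ⟨fun j => w.getD j ⟨0, by omega⟩, ?_⟩
    apply List.ext_getElem (by simp [hl])
    intro i h1 h2
    simp [h1]
  rw [key] at hw ⊢
  exact (mem_extTo N Q hQ s).2 (h ▸ (mem_extTo N P hN s).1 hw)

theorem mu_eq {k : ℕ} (hk : 2 ≤ k) (N : ℕ) (P : Finset (List (Fin k)))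
    (hP : IsPrefixCode P) (hN : ∀ p ∈ P, p.length ≤ N) :
    mu k P = (extTo N P).card / (k : ℚ) ^ N := by
  have hk0 : (k : ℚ) ≠ 0 := by exact_mod_cast (by omega : k ≠ 0)
  rw [card_extTo N P hP, mu]
  push_cast
  rw [Finset.sum_div]
  refine Finset.sum_congr rfl fun p hp => ?_
  obtain ⟨m, hm⟩ := Nat.exists_eq_add_of_le (hN p hp)
  rw [hm, Nat.add_sub_cancel_left, zpow_neg, zpow_natCast, pow_add]
  field_simp

theorem stmt2 (k : ℕ) (hk : 2 ≤ k) (P₁ P₂ : Finset (List (Fin k)))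
    (hP₁ : IsPrefixCode P₁) (hP₂ : IsPrefixCode P₂)
    (h : ends P₁ = ends P₂) :
    mu k P₁ = mu k P₂ := by
  have hN : ∀ p ∈ P₁ ∪ P₂, p.length ≤ (P₁ ∪ P₂).sup List.length :=
    fun p hp => Finset.le_sup (f := List.length) hp
  generalize (P₁ ∪ P₂).sup List.length = N at hN
  have h1 : ∀ p ∈ P₁, p.length ≤ N := fun p hp => hN p (Finset.mem_union_left _ hp)
  have h2 : ∀ p ∈ P₂, p.length ≤ N := fun p hp => hN p (Finset.mem_union_right _ hp)
  rw [mu_eq hk N P₁ hP₁ h1, mu_eq hk N P₂ hP₂ h2,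
    Finset.Subset.antisymm (extTo_sub hk N P₁ P₂ h1 h2 h) (extTo_sub hk N P₂ P₁ h2 h1 h.symm)]
end

section
/- Let P₁, P₂ ⊆ A* be finite prefix codes. If ends(P₁·A*) ⊆ ends(P₂·A*), then μ(P₁) ≤ μ(P₂); and if the inclusion ends(P₁·A*) ⊊ ends(P₂·A*) is strict, then μ(P₁) < μ(P₂). -/
theorem aux_mem_ends {k : ℕ} (P : Finset (List (Fin k))) (s : ℕ → Fin k) :
    s ∈ ends P ↔ ∃ x ∈ P, ∀ i (h : i < x.length), s i = x[i] := by
  constructor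
  · rintro ⟨n, hn⟩
    exact ⟨_, hn, fun i h => by simp⟩
  · rintro ⟨x, hx, h⟩
    refine ⟨x.length, ?_⟩
    have : (List.ofFn fun i : Fin x.length => s (i : ℕ)) = x := by
      apply List.ext_getElem
      · simp
      · intro i h1 h2
        simp [h i h2]
    rwa [this]

def auxCyl {k : ℕ} (N : ℕ) (x : List (Fin k)) : Finset (Fin N → Fin k) :=
  Fintype.piFinset fun i : Fin N => if h : (i : ℕ) < x.length then {x[(i : ℕ)]} else Finset.univ

theorem aux_mem_cyl {k : ℕ} (N : ℕ) (x : List (Fin k)) (hx : x.length ≤ N) (s : ℕ → Fin k) :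
    (fun i : Fin N => s i) ∈ auxCyl N x ↔ ∀ i (h : i < x.length), s i = x[i] := by
  simp only [auxCyl, Fintype.mem_piFinset]
  constructor
  · intro H i h
    have := H ⟨i, by omega⟩
    simpa [h] using this
  · intro H i
    by_cases h : (i : ℕ) < x.length
    · simp [h, H i h]
    · simp [h]

theorem aux_card_cyl {k : ℕ} (N : ℕ) (x : List (Fin k)) (hx : x.length ≤ N) :
    (auxCyl N x).card = k ^ (N - x.length) := by
  rw [auxCyl, Fintype.card_piFinset]
  have : ∀ i : Fin N, (if h : (i : ℕ) < x.length then ({x[(i : ℕ)]} : Finset (Fin k))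
      else Finset.univ).card = (fun j : ℕ => if j < x.length then 1 else k) i := by
    intro i
    by_cases h : (i : ℕ) < x.length <;> simp [h]
  rw [Finset.prod_congr rfl fun i _ => this i,
    Fin.prod_univ_eq_prod_range (fun j : ℕ => if j < x.length then 1 else k) N]
  obtain ⟨m, rfl⟩ := Nat.exists_eq_add_of_le hx
  rw [Finset.prod_range_add, Finset.prod_eq_one]
  · simp
  · intro i hi
    simp [Finset.mem_range.mp hi]

theorem aux_mu {k : ℕ} (hk : 2 ≤ k) (N : ℕ) (P : Finset (List (Fin k)))
    (hP : IsPrefixCode P) (hN : ∀ x ∈ P, x.length ≤ N) :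
    mu k P * (k : ℚ) ^ N = ((P.biUnion (auxCyl N)).card : ℚ) := by
  have hk0 : (k : ℚ) ≠ 0 := by
    have : k ≠ 0 := by omega
    exact_mod_cast this
  rw [Finset.card_biUnion, mu, Finset.sum_mul, Nat.cast_sum]
  · refine Finset.sum_congr rfl fun x hx => ?_
    rw [aux_card_cyl N x (hN x hx), Nat.cast_pow, pow_sub₀ _ hk0 (hN x hx), zpow_neg,
      zpow_natCast, mul_comm]
  · intro x hx y hy hxy
    rw [Function.onFun, Finset.disjoint_left]
    intro f hfx hfy
    let s : ℕ → Fin k := fun i => if h : i < N then f ⟨i, h⟩ else ⟨0, by omega⟩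
    have hs : f = fun i : Fin N => s i := by
      funext i; simp [s]
    rw [hs, aux_mem_cyl N _ (hN _ hx)] at hfx
    rw [hs, aux_mem_cyl N _ (hN _ hy)] at hfy
    have key : ∀ u v : List (Fin k), u.length ≤ v.length →
        (∀ i (h : i < u.length), s i = u[i]) → (∀ i (h : i < v.length), s i = v[i]) →
        u <+: v := by
      intro u v huv hu hv
      rw [List.prefix_iff_getElem]
      exact ⟨huv, fun i h => by rw [← hu i h, ← hv i (by omega)]⟩
    rcases le_total x.length y.length with h | h
    · exact hxy (hP x hx y hy (key x y h hfx hfy))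
    · exact hxy (hP y hy x hx (key y x h hfy hfx)).symm

theorem aux_mem_bi {k : ℕ} (N : ℕ) (P : Finset (List (Fin k)))
    (hN : ∀ x ∈ P, x.length ≤ N) (s : ℕ → Fin k) :
    (fun i : Fin N => s i) ∈ P.biUnion (auxCyl N) ↔ s ∈ ends P := by
  rw [aux_mem_ends, Finset.mem_biUnion]
  exact exists_congr fun x => and_congr_right fun hx => aux_mem_cyl N x (hN x hx) s

theorem stmt3 (k : ℕ) (hk : 2 ≤ k) (P₁ P₂ : Finset (List (Fin k)))
    (hP₁ : IsPrefixCode P₁) (hP₂ : IsPrefixCode P₂) :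
    (ends P₁ ⊆ ends P₂ → mu k P₁ ≤ mu k P₂) ∧
    (ends P₁ ⊂ ends P₂ → mu k P₁ < mu k P₂) := by
  let N := (P₁ ∪ P₂).sup List.length
  have h1 : ∀ x ∈ P₁, x.length ≤ N := fun x hx =>
    Finset.le_sup (f := List.length) (Finset.mem_union_left _ hx)
  have h2 : ∀ x ∈ P₂, x.length ≤ N := fun x hx =>
    Finset.le_sup (f := List.length) (Finset.mem_union_right _ hx)
  have hpos : (0 : ℚ) < (k : ℚ) ^ N := by
    have : (0 : ℚ) < k := by exact_mod_cast (by omega : 0 < k)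
    positivity
  have hsub : ends P₁ ⊆ ends P₂ → P₁.biUnion (auxCyl N) ⊆ P₂.biUnion (auxCyl N) := by
    intro H f hf
    let s : ℕ → Fin k := fun i => if h : i < N then f ⟨i, h⟩ else ⟨0, by omega⟩
    have hs : f = fun i : Fin N => s i := by
      funext i; simp [s]
    rw [hs, aux_mem_bi N _ h1] at hf
    rw [hs, aux_mem_bi N _ h2]
    exact H hf
  constructor
  · intro H
    refine le_of_mul_le_mul_right ?_ hpos
    rw [aux_mu hk N P₁ hP₁ h1, aux_mu hk N P₂ hP₂ h2]
    exact_mod_cast Finset.card_le_card (hsub H)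
  · intro H
    refine lt_of_mul_lt_mul_right ?_ hpos.le
    rw [aux_mu hk N P₁ hP₁ h1, aux_mu hk N P₂ hP₂ h2]
    obtain ⟨s, hs2, hs1⟩ := Set.exists_of_ssubset H
    have : P₁.biUnion (auxCyl N) ⊂ P₂.biUnion (auxCyl N) := by
      refine (Finset.ssubset_iff_of_subset (hsub H.subset)).2 ⟨fun i : Fin N => s i, ?_, ?_⟩
      · exact (aux_mem_bi N _ h2 s).2 hs2
      · exact fun h => hs1 ((aux_mem_bi N _ h1 s).1 h)
    exact_mod_cast Finset.card_lt_card this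
end

section
/- Let P ⊆ A* be a finite prefix code partitioned into pairwise disjoint nonempty classes P₁, …, Pₙ, and define noncoll = Σᵢ₌₁ⁿ k^{−ℓᵢ}, where ℓᵢ is the minimum length of a word in Pᵢ. Fix an index j and perform a class-wise replacement step: replace the class Pⱼ by the k classes Pⱼ·a₁, …, Pⱼ·a_k, where a₁, …, a_k are the letters of A. Then P′ = (P \ Pⱼ) ∪ Pⱼ·A is again a finite prefix code, the sets Pᵢ (i ≠ j) together with Pⱼ·a₁, …, Pⱼ·a_k are pairwise disjoint with union P′, and the noncoll value is unchanged: Σ_{i≠j} k^{−ℓᵢ} + Σ_{a∈A} k^{−(ℓⱼ+1)} = Σᵢ₌₁ⁿ k^{−ℓᵢ}. (In words: the amount of collision of a prefix code congruence is invariant under class-wise replacement steps.) -/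
theorem stmt8 (k : ℕ) (hk : 2 ≤ k) (n : ℕ)
    (Pc : Fin n → Finset (List (Fin k)))
    (P : Finset (List (Fin k))) (hP : IsPrefixCode P)
    (hunion : P = Finset.univ.biUnion Pc)
    (hdisj : ∀ i j : Fin n, i ≠ j → Disjoint (Pc i) (Pc j))
    (hne : ∀ i, (Pc i).Nonempty)
    (ℓ : Fin n → ℕ)
    (hℓmem : ∀ i, ∃ w ∈ Pc i, w.length = ℓ i)
    (hℓmin : ∀ i, ∀ w ∈ Pc i, ℓ i ≤ w.length)
    (j : Fin n)
    (PjA : Finset (List (Fin k)))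
    (hPjA : PjA = (Pc j).biUnion
      (fun s => (Finset.univ : Finset (Fin k)).image (fun a => s ++ [a])))
    (P' : Finset (List (Fin k))) (hP' : P' = (P \ Pc j) ∪ PjA) :
    IsPrefixCode P' ∧
    (∀ i : Fin n, i ≠ j → ∀ a : Fin k,
      Disjoint (Pc i) ((Pc j).image (fun s => s ++ [a]))) ∧
    (∀ a b : Fin k, a ≠ b →
      Disjoint ((Pc j).image (fun s => s ++ [a])) ((Pc j).image (fun s => s ++ [b]))) ∧
    ((Finset.univ.erase j).biUnion Pc ∪ PjA = P') ∧
    (∑ i ∈ Finset.univ.erase j, (k : ℚ) ^ (-(ℓ i : ℤ))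
        + ∑ _a : Fin k, (k : ℚ) ^ (-((ℓ j + 1 : ℕ) : ℤ))
      = ∑ i : Fin n, (k : ℚ) ^ (-(ℓ i : ℤ))) := by
  have hsub : ∀ i, ∀ w ∈ Pc i, w ∈ P := fun i w hw => by
    rw [hunion]; exact Finset.mem_biUnion.2 ⟨i, Finset.mem_univ _, hw⟩
  have hmemA : ∀ w, w ∈ PjA ↔ ∃ s ∈ Pc j, ∃ a, s ++ [a] = w := by
    intro w; rw [hPjA]; simp
  refine ⟨?_, ?_, ?_, ?_, ?_⟩
  · intro u hu v hv huv
    rw [hP', Finset.mem_union, Finset.mem_sdiff, hmemA] at hu hv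
    rcases hu with ⟨hu, hu'⟩ | ⟨s, hs, a, rfl⟩
    · rcases hv with ⟨hv, hv'⟩ | ⟨t, ht, b, rfl⟩
      · exact hP u hu v hv huv
      · rcases List.prefix_concat_iff.1 huv with h | h
        · exact h
        · have := hP u hu t (hsub j t ht) h
          subst this
          exact absurd ht hu'
    · have hsv : s <+: v := (List.prefix_append s [a]).trans huv
      rcases hv with ⟨hv, hv'⟩ | ⟨t, ht, b, rfl⟩
      · have := hP s (hsub j s hs) v hv hsv
        subst this
        exact absurd hs hv'
      · have hst : s = t := by
          rcases List.prefix_concat_iff.1 hsv with h | h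
          · exact (hP t (hsub j t ht) s (hsub j s hs) (h ▸ List.prefix_append t [b])).symm
          · exact hP s (hsub j s hs) t (hsub j t ht) h
        subst hst
        exact huv.eq_of_length (by simp)
  · intro i hi a
    rw [Finset.disjoint_left]
    intro w hw hw'
    obtain ⟨s, hs, rfl⟩ := Finset.mem_image.1 hw'
    have := hP s (hsub j s hs) _ (hsub i _ hw) (List.prefix_append s [a])
    simp at this
  · intro a b hab
    rw [Finset.disjoint_left]
    intro w hw hw'
    obtain ⟨s, hs, rfl⟩ := Finset.mem_image.1 hw
    obtain ⟨t, ht, h⟩ := Finset.mem_image.1 hw'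
    have h2 := (List.append_inj' h rfl).2
    simp at h2
    exact hab h2.symm
  · rw [hP']
    congr 1
    ext w
    rw [hunion]
    simp only [Finset.mem_biUnion, Finset.mem_erase, Finset.mem_sdiff, Finset.mem_univ, and_true,
      true_and]
    constructor
    · rintro ⟨i, hi, hw⟩
      exact ⟨⟨i, hw⟩, Finset.disjoint_left.1 (hdisj i j hi) hw⟩
    · rintro ⟨⟨i, hw⟩, h⟩
      exact ⟨i, fun e => h (e ▸ hw), hw⟩
  · have hk0 : (k : ℚ) ≠ 0 := by
      have : k ≠ 0 := by omega
      exact_mod_cast this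
    rw [← Finset.sum_erase_add _ _ (Finset.mem_univ j)]
    congr 1
    rw [Finset.sum_const, Finset.card_univ, Fintype.card_fin, nsmul_eq_mul, zpow_neg, zpow_neg,
      zpow_natCast, zpow_natCast, pow_succ]
    field_simp
end

section
/- Let Q ⊆ A* be a finite set of words and let a, n be natural numbers with μ(Q) = a/kⁿ. Then a ≡ |Q| (mod k−1), where |Q| is the cardinality of Q. (Consequently, the k-reduced numerator of the Bernoulli measure of the image code of an element of the Thompson–Higman monoid determines its cardinality modulo k−1, hence its D-class index.) -/
theorem stmt9 (k : ℕ) (hk : 2 ≤ k) (Q : Finset (List (Fin k))) (a n : ℕ)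
    (h : mu k Q = (a : ℚ) / (k : ℚ) ^ n) :
    a ≡ Q.card [MOD k - 1] := by
  have hk0 : (k : ℚ) ≠ 0 := by
    have : k ≠ 0 := by omega
    exact_mod_cast this
  have h1 : k ≡ 1 [MOD k - 1] := by
    have h2 : (k - 1) + 1 ≡ 1 [MOD k - 1] := by simp [Nat.ModEq]
    rwa [Nat.sub_add_cancel (by omega)] at h2
  have hp : ∀ m : ℕ, k ^ m ≡ 1 [MOD k - 1] := fun m => by
    simpa using h1.pow m
  obtain ⟨N, hN⟩ : ∃ N : ℕ, ∀ x ∈ Q, x.length ≤ N :=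
    ⟨Q.sup List.length, fun x hx => Finset.le_sup (f := List.length) hx⟩
  have key : k ^ N * a = k ^ n * ∑ x ∈ Q, k ^ (N - x.length) := by
    have hs : (∑ x ∈ Q, (k : ℚ) ^ (N - x.length)) = (k : ℚ) ^ N * mu k Q := by
      unfold mu
      rw [Finset.mul_sum]
      refine Finset.sum_congr rfl fun x hx => ?_
      rw [pow_sub₀ _ hk0 (hN x hx), zpow_neg, zpow_natCast]
    have : ((k ^ N * a : ℕ) : ℚ) = ((k ^ n * ∑ x ∈ Q, k ^ (N - x.length) : ℕ) : ℚ) := by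
      push_cast
      rw [hs, h]
      field_simp
    exact_mod_cast this
  have hsum : ∑ x ∈ Q, k ^ (N - x.length) ≡ Q.card [MOD k - 1] := by
    rw [Finset.card_eq_sum_ones]
    clear key h hN
    induction Q using Finset.induction_on with
    | empty => rfl
    | insert x s hx ih =>
      rw [Finset.sum_insert hx, Finset.sum_insert hx]
      exact (hp _).add ih
  have e1 : k ^ N * a ≡ a [MOD k - 1] := by simpa using (hp N).mul_right a
  have e2 := (hp n).mul hsum
  rw [one_mul, ← key] at e2
  exact e1.symm.trans e2
end

section
/- For every nonempty finite prefix code P ⊆ A* and every natural number j, there exists a finite prefix code P′ ⊆ A* with |P′| = |P| + j·(k−1), μ(P′) = μ(P), and ends(P′·A*) = ends(P·A*). -/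
theorem stmt10_step (k : ℕ) (hk : 2 ≤ k) (P : Finset (List (Fin k)))
    (hP : IsPrefixCode P) (hne : P.Nonempty) :
    ∃ P' : Finset (List (Fin k)),
      IsPrefixCode P' ∧ P'.card = P.card + (k - 1) ∧
      mu k P' = mu k P ∧ ends P' = ends P := by
  classical
  obtain ⟨x, hx⟩ := hne
  have hinj : Function.Injective (fun a : Fin k => x ++ [a]) := by
    intro a b h
    simpa using h
  have hnot : ∀ a : Fin k, x ++ [a] ∉ P := by
    intro a h
    have := hP x hx _ h (List.prefix_append _ _)
    simpa using congrArg List.length this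
  have hdisj : Disjoint (P.erase x) (Finset.univ.image (fun a : Fin k => x ++ [a])) := by
    rw [Finset.disjoint_left]
    intro y hy hy'
    simp only [Finset.mem_image, Finset.mem_univ, true_and] at hy'
    obtain ⟨a, rfl⟩ := hy'
    exact hnot a (Finset.mem_of_mem_erase hy)
  refine ⟨P.erase x ∪ Finset.univ.image (fun a : Fin k => x ++ [a]), ?_, ?_, ?_, ?_⟩
  · intro u hu v hv huv
    simp only [Finset.mem_union, Finset.mem_erase, Finset.mem_image, Finset.mem_univ,
      true_and] at hu hv
    rcases hu with ⟨hux, hu⟩ | ⟨a, rfl⟩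
    · rcases hv with ⟨hvx, hv⟩ | ⟨b, rfl⟩
      · exact hP u hu v hv huv
      · rcases List.prefix_concat_iff.1 huv with h | h
        · exact h
        · exact absurd (hP u hu x hx h) hux
    · rcases hv with ⟨hvx, hv⟩ | ⟨b, rfl⟩
      · exact absurd (hP x hx v hv ((List.prefix_append _ _).trans huv)).symm hvx
      · exact huv.eq_of_length (by simp)
  · rw [Finset.card_union_of_disjoint hdisj, Finset.card_image_of_injective _ hinj,
      Finset.card_erase_of_mem hx, Finset.card_univ, Fintype.card_fin]
    have := Finset.card_pos.2 ⟨x, hx⟩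
    omega
  · unfold mu
    rw [Finset.sum_union hdisj, Finset.sum_image (fun a _ b _ h => hinj h),
      ← Finset.sum_erase_add P _ hx]
    congr 1
    have hk0 : (k : ℚ) ≠ 0 := by
      have : k ≠ 0 := by omega
      exact_mod_cast this
    simp only [List.length_append, List.length_singleton, Finset.sum_const, Finset.card_univ,
      Fintype.card_fin, nsmul_eq_mul, zpow_neg, zpow_natCast, pow_succ]
    field_simp
  · ext s
    have hs : ∀ n : ℕ, (List.ofFn fun i : Fin (n + 1) => s (i : ℕ))
        = (List.ofFn fun i : Fin n => s (i : ℕ)) ++ [s n] := by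
      intro n
      rw [List.ofFn_succ_last]
      simp
    simp only [ends, Set.mem_setOf_eq, Finset.mem_union, Finset.mem_erase, Finset.mem_image,
      Finset.mem_univ, true_and]
    constructor
    · rintro ⟨n, ⟨_, h⟩ | ⟨a, h⟩⟩
      · exact ⟨n, h⟩
      · cases n with
        | zero => simp at h
        | succ n =>
          rw [hs] at h
          refine ⟨n, ?_⟩
          rw [← (List.append_inj' h rfl).1]
          exact hx
    · rintro ⟨n, h⟩
      by_cases hn : (List.ofFn fun i : Fin n => s (i : ℕ)) = x
      · exact ⟨n + 1, Or.inr ⟨s n, by rw [hs, hn]⟩⟩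
      · exact ⟨n, Or.inl ⟨hn, h⟩⟩

theorem stmt10 (k : ℕ) (hk : 2 ≤ k) (P : Finset (List (Fin k)))
    (hP : IsPrefixCode P) (hne : P.Nonempty) (j : ℕ) :
    ∃ P' : Finset (List (Fin k)),
      IsPrefixCode P' ∧ P'.card = P.card + j * (k - 1) ∧
      mu k P' = mu k P ∧ ends P' = ends P := by
  induction j with
  | zero => exact ⟨P, hP, by simp, rfl, rfl⟩
  | succ j ih =>
    obtain ⟨Q, hQ, hc, hm, he⟩ := ih
    have hQne : Q.Nonempty := by
      rw [← Finset.card_pos, hc]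
      have := Finset.card_pos.2 hne
      omega
    obtain ⟨R, hR, hc', hm', he'⟩ := stmt10_step k hk Q hQ hQne
    exact ⟨R, hR, by rw [hc', hc]; ring, hm'.trans hm, he'.trans he⟩
end

section
/- Let P ⊆ A* be a finite prefix code and let f : P → A* be a function whose image f(P) is a prefix code. Let n be a natural number at least as large as the length of the longest word in f(P). Then there exist a finite prefix code P′ ⊆ P·A* with ends(P′·A*) = ends(P·A*) and a function f′ : P′ → A* such that every word in the image of f′ has length exactly n, and for all p ∈ P and w ∈ A* with p·w ∈ P′, f′(p·w) = f(p)·w. (In words: every right-ideal homomorphism whose image code is a prefix code has an essentially equal restriction all of whose image-code words have the same length.) -/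
/-- The right ideal `X·A*` generated by a set of words `X`. -/
def rightIdeal {k : ℕ} (X : Set (List (Fin k))) : Set (List (Fin k)) :=
  {w | ∃ x ∈ X, x <+: w}

theorem stmt16 (k : ℕ) (hk : 2 ≤ k) (P : Finset (List (Fin k)))
    (hP : IsPrefixCode P)
    (f : List (Fin k) → List (Fin k))
    (hfpc : ∀ p ∈ P, ∀ q ∈ P, f p <+: f q → f p = f q)
    (n : ℕ) (hn : ∀ p ∈ P, (f p).length ≤ n) :
    ∃ (P' : Finset (List (Fin k))) (f' : List (Fin k) → List (Fin k)),
      IsPrefixCode P' ∧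
      (↑P' : Set (List (Fin k))) ⊆ rightIdeal (↑P : Set (List (Fin k))) ∧
      ends P' = ends P ∧
      (∀ q ∈ P', (f' q).length = n) ∧
      (∀ p ∈ P, ∀ w : List (Fin k), p ++ w ∈ P' → f' (p ++ w) = f p ++ w) := by
  classical
  have uniq : ∀ p ∈ P, ∀ q ∈ P, ∀ x : List (Fin k), p <+: x → q <+: x → p = q := by
    intro p hp q hq x h1 h2
    rcases List.prefix_or_prefix_of_prefix h1 h2 with h | h
    · exact hP p hp q hq h
    · exact (hP q hq p hp h).symm
  have hex : ∀ q : List (Fin k), ∃ r : List (Fin k), ∀ p ∈ P, ∀ w, q = p ++ w → r = f p ++ w := by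
    intro q
    by_cases h : ∃ p ∈ P, ∃ w, q = p ++ w
    · obtain ⟨p, hp, w, rfl⟩ := h
      refine ⟨f p ++ w, fun p' hp' w' h => ?_⟩
      have : p = p' := uniq p hp p' hp' (p ++ w) ⟨w, rfl⟩ ⟨w', h.symm⟩
      subst this
      rw [List.append_cancel_left h]
    · exact ⟨[], fun p hp w hw => absurd ⟨p, hp, w, hw⟩ h⟩
  choose f' hf' using hex
  obtain ⟨P', hP'⟩ : ∃ P' : Finset (List (Fin k)), ∀ q, q ∈ P' ↔
      ∃ p ∈ P, ∃ w : List (Fin k), w.length = n - (f p).length ∧ q = p ++ w := by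
    refine ⟨P.biUnion fun p => Finset.univ.image
      fun v : Fin (n - (f p).length) → Fin k => p ++ List.ofFn v, fun q => ?_⟩
    simp only [Finset.mem_biUnion, Finset.mem_image, Finset.mem_univ, true_and]
    constructor
    · rintro ⟨p, hp, v, rfl⟩
      exact ⟨p, hp, _, by simp, rfl⟩
    · rintro ⟨p, hp, w, hw, rfl⟩
      refine ⟨p, hp, ?_⟩
      rw [← hw]
      exact ⟨w.get, by rw [List.ofFn_get]⟩
  refine ⟨P', f', ?_, ?_, ?_, ?_, ?_⟩
  · intro u hu v hv huv
    obtain ⟨p, hp, w, hw, rfl⟩ := (hP' u).1 hu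
    obtain ⟨p', hp', w', hw', rfl⟩ := (hP' v).1 hv
    have : p = p' := uniq p hp p' hp' (p' ++ w') ((List.prefix_append p w).trans huv) ⟨w', rfl⟩
    subst this
    exact huv.eq_of_length (by simp [hw, hw'])
  · intro q hq
    obtain ⟨p, hp, w, hw, rfl⟩ := (hP' q).1 hq
    exact ⟨p, hp, w, rfl⟩
  · ext s
    constructor
    · rintro ⟨m, hm⟩
      obtain ⟨p, hp, w, hw, h⟩ := (hP' _).1 hm
      refine ⟨p.length, ?_⟩
      have hl := congrArg List.length h
      simp only [List.length_ofFn, List.length_append] at hl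
      subst hl
      rw [List.ofFn_add] at h
      have := (List.append_inj h (by simp)).1
      exact (congrArg (· ∈ P) this).mpr hp
    · rintro ⟨m, hm⟩
      refine ⟨m + (n - (f (List.ofFn fun i : Fin m => s (i : ℕ))).length), (hP' _).2 ?_⟩
      refine ⟨_, hm, _, ?_, List.ofFn_add⟩
      simp
  · intro q hq
    obtain ⟨p, hp, w, hw, rfl⟩ := (hP' q).1 hq
    rw [hf' _ p hp w rfl, List.length_append, hw]
    have := hn p hp
    omega
  · intro p hp w _
    exact hf' _ p hp w rfl
end
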